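/- Let M be a matroid on a finite ground set X with independent-set family ℐ, let f : 2^X → ℝ≥0 be a nonnegative submodular function with multilinear extension F, and let t ∈ [0, (3 − √5)/2]. Suppose x ∈ P_t(M) = conv{1_I : I ∈ ℐ} ∩ [0,t]^X is a fractional local optimum, i.e. (all derivatives at x): ∂F/∂x_i ≥ 0 whenever x − ε e_i ∈ P_t(M) for some ε > 0; ∂F/∂x_j ≤ 0 whenever x + ε e_j ∈ P_t(M) for some ε > 0; and ∂F/∂x_j ≤ ∂F/∂x_i whenever x + ε(e_j − e_i) ∈ P_t(M) for some ε > 0. Then for every independent set C ∈ ℐ, F(x) ≥ (t − t²/2) · f(C); in particular F(x) ≥ (t − t²/2) · max{f(S) : S ∈ ℐ}. -/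

import Mathlib

/-- The multilinear extension `F(x) = ∑_{S⊆X} f(S) ∏_{i∈S} x_i ∏_{j∉S} (1 - x_j)`. -/
noncomputable def mExt {X : Type*} [Fintype X] [DecidableEq X]
    (f : Set X → ℝ) (x : X → ℝ) : ℝ :=
  ∑ S : Finset X, f ↑S * ((∏ i ∈ S, x i) * ∏ j ∈ Sᶜ, (1 - x j))

/-- The box-constrained matroid polytope
`P_t(M) = conv{1_I : I independent in M} ∩ [0,t]^X`. -/
noncomputable def indepPolytopeT {X : Type*} [Fintype X] (M : Matroid X) (t : ℝ) :
    Set (X → ℝ) :=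
  (convexHull ℝ) {v : X → ℝ | ∃ I : Set X, M.Indep I ∧ v = Set.indicator I 1}
    ∩ {y : X → ℝ | ∀ i, y i ∈ Set.Icc 0 t}

theorem mExt_eq_sum_erase {X : Type*} [Fintype X] [DecidableEq X] (f : Set X → ℝ) (x : X → ℝ)
    (i : X) :
    mExt f x = ∑ S ∈ (Finset.univ.erase i).powerset,
      ((1 - x i) * f ↑S + x i * f (insert i ↑S)) *
        ∏ j ∈ Finset.univ.erase i, if j ∈ S then x j else 1 - x j := by
  have hw (S : Finset X) : (∏ i ∈ S, x i) * ∏ j ∈ Sᶜ, (1 - x j) =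
      ∏ j, if j ∈ S then x j else 1 - x j := by
    rw [← Finset.prod_mul_prod_compl S]
    congr 1
    · exact Finset.prod_congr rfl fun j hj => by simp [hj]
    · exact Finset.prod_congr rfl fun j hj => by simp [Finset.mem_compl.1 hj]
  have hu : (Finset.univ : Finset (Finset X)) =
      (insert i (Finset.univ.erase i : Finset X)).powerset := by
    rw [Finset.insert_erase (Finset.mem_univ i), Finset.powerset_univ]
  unfold mExt
  simp only [hw]
  rw [hu, Finset.sum_powerset_insert (Finset.notMem_erase i _), ← Finset.sum_add_distrib]
  refine Finset.sum_congr rfl fun S hS => ?_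
  have hi : i ∉ S := fun h => Finset.notMem_erase i _ (Finset.mem_powerset.1 hS h)
  rw [← Finset.mul_prod_erase _ _ (Finset.mem_univ i),
    ← Finset.mul_prod_erase Finset.univ (fun j => if j ∈ insert i S then x j else 1 - x j)
      (Finset.mem_univ i)]
  have h2 : (∏ j ∈ Finset.univ.erase i, if j ∈ insert i S then x j else 1 - x j) =
      ∏ j ∈ Finset.univ.erase i, if j ∈ S then x j else 1 - x j :=
    Finset.prod_congr rfl fun j hj => by simp [Finset.ne_of_mem_erase hj]
  rw [h2]
  simp [hi]
  ring

/-- The marginal value of `i`, as a function of the set it is added to. -/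
def marginal {X : Type*} (i : X) (f : Set X → ℝ) (S : Set X) : ℝ :=
  f (insert i S) - f (S \ {i})

theorem mExt_add_smul_single {X : Type*} [Fintype X] [DecidableEq X] (f : Set X → ℝ) (x : X → ℝ)
    (i : X) (s : ℝ) :
    mExt f (x + s • Pi.single i 1) = mExt f x + s * mExt (marginal i f) x := by
  rw [mExt_eq_sum_erase f _ i, mExt_eq_sum_erase f x i, mExt_eq_sum_erase (marginal i f) x i,
    Finset.mul_sum, ← Finset.sum_add_distrib]
  refine Finset.sum_congr rfl fun S hS => ?_
  have hi : i ∉ S := fun h => Finset.notMem_erase i _ (Finset.mem_powerset.1 hS h)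
  have h2 : (∏ j ∈ Finset.univ.erase i, if j ∈ S then (x + s • (Pi.single i 1 : X → ℝ)) j
        else 1 - (x + s • (Pi.single i 1 : X → ℝ)) j) =
      ∏ j ∈ Finset.univ.erase i, if j ∈ S then x j else 1 - x j :=
    Finset.prod_congr rfl fun j hj => by simp [Finset.ne_of_mem_erase hj]
  have h3 : (S : Set X) \ {i} = S := Set.sdiff_singleton_eq_self (by simpa using hi)
  have h4 : (insert i (S : Set X)) \ {i} = S := Set.insert_sdiff_self_of_notMem (by simpa using hi)
  rw [h2]
  simp only [marginal, h3, h4, Set.insert_idem, Pi.add_apply, Pi.smul_apply, Pi.single_eq_same,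
    smul_eq_mul]
  ring

theorem differentiable_mExt {X : Type*} [Fintype X] [DecidableEq X] (f : Set X → ℝ) :
    Differentiable ℝ (mExt f) := by
  unfold mExt
  fun_prop

theorem fderiv_mExt_single {X : Type*} [Fintype X] [DecidableEq X] (f : Set X → ℝ) (x : X → ℝ)
    (i : X) : fderiv ℝ (mExt f) x (Pi.single i 1) = mExt (marginal i f) x := by
  rw [← ((differentiable_mExt f) x).lineDeriv_eq_fderiv, lineDeriv]
  simp only [mExt_add_smul_single]
  simp

theorem hasDerivAt_mExt_line {X : Type*} [Fintype X] [DecidableEq X] (f : Set X → ℝ)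
    (a d : X → ℝ) (s : ℝ) :
    HasDerivAt (fun s : ℝ => mExt f (a + s • d))
      (∑ i, d i * mExt (marginal i f) (a + s • d)) s := by
  have h1 : HasDerivAt (fun s : ℝ => a + s • d) d s := by
    simpa using ((hasDerivAt_id s).smul_const d).const_add a
  have h2 := ((differentiable_mExt f) (a + s • d)).hasFDerivAt.comp_hasDerivAt s h1
  have h3 : d = ∑ i, d i • (Pi.single i 1 : X → ℝ) := by
    ext j
    simp [Finset.sum_apply, Pi.single_apply]
  have h4 := congrArg (fderiv ℝ (mExt f) (a + s • d)) h3
  simp only [map_sum, map_smul, smul_eq_mul, fderiv_mExt_single] at h4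
  rwa [h4] at h2

theorem exists_mExt_sub_eq {X : Type*} [Fintype X] [DecidableEq X] (f : Set X → ℝ)
    (a d : X → ℝ) : ∃ s ∈ Set.Ioo (0 : ℝ) 1,
      mExt f (a + d) - mExt f a = ∑ i, d i * mExt (marginal i f) (a + s • d) := by
  obtain ⟨s, hs, h⟩ := exists_hasDerivAt_eq_slope (fun s : ℝ => mExt f (a + s • d)) _ zero_lt_one
    (fun _ _ => (hasDerivAt_mExt_line f a d _).continuousAt.continuousWithinAt)
    (fun _ _ => hasDerivAt_mExt_line f a d _)
  exact ⟨s, hs, by simpa using h.symm⟩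

theorem mExt_nonneg {X : Type*} [Fintype X] [DecidableEq X] {f : Set X → ℝ} (hf : ∀ S, 0 ≤ f S)
    {x : X → ℝ} (h0 : ∀ i, 0 ≤ x i) (h1 : ∀ i, x i ≤ 1) : 0 ≤ mExt f x :=
  Finset.sum_nonneg fun _ _ => mul_nonneg (hf _) (mul_nonneg
    (Finset.prod_nonneg fun i _ => h0 i) (Finset.prod_nonneg fun i _ => sub_nonneg.2 (h1 i)))

theorem mExt_neg {X : Type*} [Fintype X] [DecidableEq X] (f : Set X → ℝ) (x : X → ℝ) :
    mExt (-f) x = -mExt f x := by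
  simp [mExt]

theorem mExt_nonpos {X : Type*} [Fintype X] [DecidableEq X] {f : Set X → ℝ} (hf : ∀ S, f S ≤ 0)
    {x : X → ℝ} (h0 : ∀ i, 0 ≤ x i) (h1 : ∀ i, x i ≤ 1) : mExt f x ≤ 0 := by
  have := mExt_nonneg (f := -f) (fun S => neg_nonneg.2 (hf S)) h0 h1
  rw [mExt_neg] at this
  linarith

theorem mExt_le_of_antitone {X : Type*} [Fintype X] [DecidableEq X] {f : Set X → ℝ}
    (hf : Antitone f) {x y : X → ℝ} (hxy : x ≤ y) (h0 : ∀ i, 0 ≤ x i) (h1 : ∀ i, y i ≤ 1) :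
    mExt f y ≤ mExt f x := by
  obtain ⟨s, hs, h⟩ := exists_mExt_sub_eq f x (y - x)
  rw [add_sub_cancel] at h
  rw [← sub_nonpos, h]
  refine Finset.sum_nonpos fun i _ => mul_nonpos_of_nonneg_of_nonpos (sub_nonneg.2 (hxy i))
    (mExt_nonpos (fun S => sub_nonpos.2 (hf (Set.sdiff_subset.trans (Set.subset_insert _ _))))
      (fun j => ?_) (fun j => ?_))
  · have := hxy j
    have := h0 j
    have := hs.1
    simp only [Pi.add_apply, Pi.smul_apply, Pi.sub_apply, smul_eq_mul]
    nlinarith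
  · have := hxy j
    have := h1 j
    have := hs.2
    simp only [Pi.add_apply, Pi.smul_apply, Pi.sub_apply, smul_eq_mul]
    nlinarith

theorem antitone_marginal {X : Type*} {f : Set X → ℝ}
    (hsub : ∀ S T : Set X, f (S ∪ T) + f (S ∩ T) ≤ f S + f T) (i : X) :
    Antitone (marginal i f) := by
  intro S T hST
  have h := hsub (insert i S) (T \ {i})
  have h1 : insert i S ∪ T \ {i} = insert i T := by
    ext j
    have := @hST j
    simp only [Set.mem_union, Set.mem_insert_iff, Set.mem_sdiff, Set.mem_singleton_iff]
    tauto
  have h2 : insert i S ∩ (T \ {i}) = S \ {i} := by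
    ext j
    have := @hST j
    simp only [Set.mem_inter_iff, Set.mem_insert_iff, Set.mem_sdiff, Set.mem_singleton_iff]
    tauto
  rw [h1, h2] at h
  unfold marginal
  linarith

theorem mExt_indicator {X : Type*} [Fintype X] [DecidableEq X] (f : Set X → ℝ) (S : Set X) :
    mExt f (S.indicator 1) = f S := by
  classical
  unfold mExt
  rw [Finset.sum_eq_single S.toFinset]
  · rw [Finset.prod_eq_one, Finset.prod_eq_one] <;> simp +contextual
  · intro T _ hT
    rw [mul_eq_zero]
    right
    by_cases h : ∃ i ∈ T, i ∉ S
    · obtain ⟨i, hi, hiS⟩ := h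
      rw [Finset.prod_eq_zero hi (by simp [hiS]), zero_mul]
    · push Not at h
      obtain ⟨i, hiS, hi⟩ : ∃ i ∈ S, i ∉ T := by
        by_contra! h'
        exact hT (Finset.ext fun i => by simpa using ⟨h i, h' i⟩)
      rw [Finset.prod_eq_zero (i := i) (s := Tᶜ) (by simpa) (by simp [hiS]), mul_zero]
  · simp

theorem mExt_sub_le {X : Type*} [Fintype X] [DecidableEq X] {f : Set X → ℝ}
    (hsub : ∀ S T : Set X, f (S ∪ T) + f (S ∩ T) ≤ f S + f T)
    {a d : X → ℝ} (ha : ∀ i, 0 ≤ a i) (hd : ∀ i, 0 ≤ d i)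
    (h1 : ∀ i, a i + d i ≤ 1) :
    mExt f (a + d) - mExt f a ≤ ∑ i, d i * mExt (marginal i f) a := by
  obtain ⟨s, hs, h⟩ := exists_mExt_sub_eq f a d
  rw [h]
  refine Finset.sum_le_sum fun i _ => mul_le_mul_of_nonneg_left
    (mExt_le_of_antitone (antitone_marginal hsub i) ?_ ha fun j => ?_) (hd i)
  · intro j
    simpa using mul_nonneg hs.1.le (hd j)
  · have := mul_le_of_le_one_left (hd j) hs.2.le
    have := h1 j
    simp only [Pi.add_apply, Pi.smul_apply, smul_eq_mul]
    linarith

theorem le_mExt_sub {X : Type*} [Fintype X] [DecidableEq X] {f : Set X → ℝ}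
    (hsub : ∀ S T : Set X, f (S ∪ T) + f (S ∩ T) ≤ f S + f T)
    {a d : X → ℝ} (ha : ∀ i, 0 ≤ a i) (hd : ∀ i, 0 ≤ d i)
    (h1 : ∀ i, a i + d i ≤ 1) :
    ∑ i, d i * mExt (marginal i f) (a + d) ≤ mExt f (a + d) - mExt f a := by
  obtain ⟨s, hs, h⟩ := exists_mExt_sub_eq f a d
  rw [h]
  refine Finset.sum_le_sum fun i _ => mul_le_mul_of_nonneg_left
    (mExt_le_of_antitone (antitone_marginal hsub i) ?_ (fun j => ?_) h1) (hd i)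
  · intro j
    simpa using mul_le_of_le_one_left (hd j) hs.2.le
  · exact add_nonneg (ha j) (mul_nonneg hs.1.le (hd j))

theorem mExt_add_sub_le_of_le {X : Type*} [Fintype X] [DecidableEq X] {f : Set X → ℝ}
    (hsub : ∀ S T : Set X, f (S ∪ T) + f (S ∩ T) ≤ f S + f T)
    {a b d : X → ℝ} (hab : a ≤ b) (ha : ∀ i, 0 ≤ a i)
    (hd : ∀ i, 0 ≤ d i) (h1 : ∀ i, b i + d i ≤ 1) :
    mExt f (b + d) - mExt f b ≤ mExt f (a + d) - mExt f a := by
  have hder (s : ℝ) := (hasDerivAt_mExt_line f b d s).sub (hasDerivAt_mExt_line f a d s)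
  obtain ⟨s, hs, h⟩ := exists_hasDerivAt_eq_slope _ _ zero_lt_one
    (fun _ _ => (hder _).continuousAt.continuousWithinAt) (fun _ _ => hder _)
  have : (∑ i, d i * mExt (marginal i f) (b + s • d)) ≤
      ∑ i, d i * mExt (marginal i f) (a + s • d) := by
    refine Finset.sum_le_sum fun i _ => mul_le_mul_of_nonneg_left
      (mExt_le_of_antitone (antitone_marginal hsub i) ?_ (fun j => ?_) fun j => ?_) (hd i)
    · exact add_le_add_left hab _
    · exact add_nonneg (ha j) (mul_nonneg hs.1.le (hd j))
    · have := mul_le_of_le_one_left (hd j) hs.2.le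
      have := h1 j
      simp only [Pi.add_apply, Pi.smul_apply, smul_eq_mul]
      linarith
  simp at h
  linarith

theorem le_mExt_add_smul {X : Type*} [Fintype X] [DecidableEq X] {f : Set X → ℝ}
    (hsub : ∀ S T : Set X, f (S ∪ T) + f (S ∩ T) ≤ f S + f T)
    {a d : X → ℝ} (ha : ∀ i, 0 ≤ a i) (hd : ∀ i, 0 ≤ d i)
    (h1 : ∀ i, a i + d i ≤ 1) {t : ℝ} (ht0 : 0 ≤ t) (ht1 : t ≤ 1) :
    (1 - t) * mExt f a + t * mExt f (a + d) ≤ mExt f (a + t • d) := by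
  have hA := le_mExt_sub hsub (a := a) (d := t • d) ha (fun i => mul_nonneg ht0 (hd i))
    (fun i => by
      have := mul_le_of_le_one_left (hd i) ht1
      have := h1 i
      simp only [Pi.smul_apply, smul_eq_mul]
      linarith)
  have hB := mExt_sub_le hsub (a := a + t • d) (d := (1 - t) • d)
    (fun i => add_nonneg (ha i) (mul_nonneg ht0 (hd i)))
    (fun i => mul_nonneg (sub_nonneg.2 ht1) (hd i))
    (fun i => by
      have := h1 i
      simp only [Pi.add_apply, Pi.smul_apply, smul_eq_mul]
      linarith)
  have hd' : a + t • d + (1 - t) • d = a + d := by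
    rw [add_assoc, ← add_smul, add_sub_cancel, one_smul]
  rw [hd'] at hB
  simp only [Pi.smul_apply, smul_eq_mul, mul_assoc, ← Finset.mul_sum] at hA hB
  nlinarith [mul_le_mul_of_nonneg_left hB ht0, mul_le_mul_of_nonneg_left hA (sub_nonneg.2 ht1)]

theorem Matroid.Indep.exists_injective_exchange {α : Type*} [Finite α] {M : Matroid α}
    {I C : Set α} (hI : M.Indep I) (hC : M.Indep C) :
    ∃ σ : {j // j ∈ C \ I ∧ ¬ M.Indep (insert j I)} → α, Function.Injective σ ∧
      ∀ j, σ j ∈ I \ C ∧ M.Indep (insert ↑j I \ {σ j}) := by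
  classical
  cases nonempty_fintype α
  suffices hall : ∀ s : Finset {j // j ∈ C \ I ∧ ¬ M.Indep (insert j I)},
      s.card ≤ (s.biUnion fun j => Finset.univ.filter fun i =>
        i ∈ I \ C ∧ M.Indep (insert ↑j I \ {i})).card by
    obtain ⟨σ, hσ, h⟩ := (Finset.all_card_le_biUnion_card_iff_exists_injective _).1 hall
    exact ⟨σ, hσ, fun j => by simpa using h j⟩
  by_contra! ⟨s, hs⟩
  set N := s.biUnion fun j => Finset.univ.filter fun i =>
    i ∈ I \ C ∧ M.Indep (insert ↑j I \ {i}) with hN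
  have hmem {i : α} : i ∈ N ↔ ∃ j ∈ s, i ∈ I \ C ∧ M.Indep (insert ↑j I \ {i}) := by
    simp [hN]
  set J := s.image Subtype.val with hJ
  have hJmem {j : α} (hj : j ∈ J) : j ∈ C \ I := by
    obtain ⟨j, -, rfl⟩ := Finset.mem_image.1 hj
    exact j.2.1
  have hK : M.Indep (I ∩ C ∪ N) := hI.subset <| Set.union_subset Set.inter_subset_left
    fun i hi => by
      obtain ⟨j, -, h, -⟩ := hmem.1 hi
      exact h.1
  have hL : M.Indep (I ∩ C ∪ J) := hC.subset <| Set.union_subset Set.inter_subset_right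
    fun j hj => (hJmem hj).1
  have hcard : (I ∩ C ∪ N).encard < (I ∩ C ∪ J).encard := by
    rw [Set.encard_union_eq, Set.encard_union_eq, Set.encard_coe_eq_coe_finsetCard,
      Set.encard_coe_eq_coe_finsetCard, hJ, Finset.card_image_of_injective _ Subtype.val_injective]
    · exact (ENat.add_lt_add_iff_left (Set.encard_ne_top_iff.2 (Set.toFinite _))).2
        (by exact_mod_cast hs)
    · exact Set.disjoint_left.2 fun j h hj => (hJmem hj).2 h.1
    · refine Set.disjoint_left.2 fun i h hi => ?_
      obtain ⟨j, -, h', -⟩ := hmem.1 hi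
      exact h'.2 h.2
  obtain ⟨e, ⟨heL, heK⟩, he⟩ := hK.augment hL hcard
  have heJ : e ∈ J := heL.resolve_left fun h => heK (Or.inl h)
  obtain ⟨j, hj, rfl⟩ := Finset.mem_image.1 heJ
  have hjE : ↑j ∈ M.E := hC.subset_ground j.2.1.1
  have hjcl : ↑j ∈ M.closure I := hI.mem_closure_iff.2 <| Or.inl <|
    (Matroid.not_indep_iff (Set.insert_subset hjE hI.subset_ground)).1 j.2.2
  refine (hI.fundCircuit_isCircuit hjcl j.2.1.2).not_indep (he.subset fun i hi => ?_)
  rcases Matroid.fundCircuit_subset_insert _ _ _ hi with rfl | hiI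
  · exact Set.mem_insert _ _
  · refine Or.inr ?_
    by_cases hiC : i ∈ C
    · exact Or.inl ⟨hiI, hiC⟩
    · exact Or.inr (hmem.2 ⟨j, hj, ⟨hiI, hiC⟩, (hI.mem_fundCircuit_iff hjcl j.2.1.2).1 hi⟩)

theorem add_smul_sub_mem_convexHull {E ι : Type*} [AddCommGroup E] [Module ℝ E] [Fintype ι]
    {V : Set E} {w : ι → ℝ} {z : ι → E} (hw0 : ∀ k, 0 ≤ w k) (hw1 : ∑ k, w k = 1)
    (hz : ∀ k, z k ∈ V) {v : E} (hv : v ∈ V) (k : ι) {ε : ℝ} (hε0 : 0 ≤ ε) (hε : ε ≤ w k) :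
    ∑ k, w k • z k + ε • (v - z k) ∈ convexHull ℝ V := by
  classical
  have h := (convex_convexHull ℝ V).sum_mem (t := Finset.univ)
    (w := fun o : Option ι => o.elim ε fun l => w l - if l = k then ε else 0)
    (z := fun o : Option ι => o.elim v z) ?_ ?_ ?_
  · convert h using 1
    simp only [Fintype.sum_option, Option.elim, sub_smul, Finset.sum_sub_distrib, ite_smul,
      zero_smul, Finset.sum_ite_eq', Finset.mem_univ, if_true, smul_sub]
    abel
  · rintro (_ | l) -
    · exact hε0
    · simp only [Option.elim]
      split_ifs with h
      · subst h
        linarith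
      · simpa using hw0 l
  · simp [Fintype.sum_option, Finset.sum_sub_distrib, hw1]
  · rintro (_ | l) -
    · exact subset_convexHull ℝ V hv
    · exact subset_convexHull ℝ V (hz l)

theorem Matroid.Indep.sum_indicator_sdiff_le {X : Type*} [Fintype X] {M : Matroid X}
    {I B C : Set X} (hI : M.Indep I) (hC : M.Indep C) (hBC : B ⊆ C) {D : X → ℝ}
    (h0 : ∀ i ∈ I, 0 ≤ D i) (h1 : ∀ j ∈ B \ I, M.Indep (insert j I) → D j ≤ 0)
    (h2 : ∀ j ∈ B \ I, ∀ i ∈ I, M.Indep (insert j I \ {i}) → D j ≤ D i) :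
    ∑ j, (B \ I).indicator D j ≤ ∑ i, (I \ C).indicator D i := by
  classical
  obtain ⟨σ, hσ, h⟩ := hI.exists_injective_exchange hC
  have hnn (i : X) : 0 ≤ (I \ C).indicator D i := Set.indicator_nonneg (fun i hi => h0 i hi.1) i
  calc ∑ j, (B \ I).indicator D j
      = ∑ j : {j // j ∈ C \ I ∧ ¬ M.Indep (insert j I)}, (B \ I).indicator D j +
        ∑ j : {j // ¬ (j ∈ C \ I ∧ ¬ M.Indep (insert j I))}, (B \ I).indicator D j :=
        (Fintype.sum_subtype_add_sum_subtype _ _).symm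
    _ ≤ ∑ j, (I \ C).indicator D (σ j) + 0 := by
        refine add_le_add (Finset.sum_le_sum fun j _ => ?_)
          (Finset.sum_nonpos fun j _ => Set.indicator_apply_le' (fun hj => ?_) fun _ => le_rfl)
        · refine Set.indicator_apply_le' (fun hj => ?_) fun _ => hnn _
          rw [Set.indicator_of_mem (h j).1]
          exact h2 j hj _ (h j).1.1 (h j).2
        · refine h1 j hj ?_
          by_contra hni
          exact j.2 ⟨⟨hBC hj.1, hj.2⟩, hni⟩
    _ = ∑ i ∈ Finset.univ.image σ, (I \ C).indicator D i := by
        rw [add_zero, Finset.sum_image hσ.injOn]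
    _ ≤ ∑ i, (I \ C).indicator D i := Finset.sum_le_univ_sum_of_nonneg hnn

theorem sum_le_sum_of_isLocalOpt {X : Type*} [Fintype X] [DecidableEq X] {M : Matroid X}
    {t : ℝ} {x : X → ℝ} (hx : x ∈ indepPolytopeT M t) {D : X → ℝ}
    (h0 : ∀ i : X, (∃ ε > (0 : ℝ), x - ε • (Pi.single i 1 : X → ℝ) ∈ indepPolytopeT M t) →
      0 ≤ D i)
    (h1 : ∀ j : X, (∃ ε > (0 : ℝ), x + ε • (Pi.single j 1 : X → ℝ) ∈ indepPolytopeT M t) →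
      D j ≤ 0)
    (h2 : ∀ i j : X, (∃ ε > (0 : ℝ),
      x + ε • ((Pi.single j 1 : X → ℝ) - Pi.single i 1) ∈ indepPolytopeT M t) → D j ≤ D i)
    {B C : Set X} (hC : M.Indep C) (hBC : B ⊆ C) (hB : ∀ j ∈ B, x j < t) :
    ∑ j, B.indicator (1 - x) j * D j ≤ ∑ i, Cᶜ.indicator x i * D i := by
  classical
  obtain ⟨hconv, hbox⟩ := hx
  obtain ⟨ι, _, w, z, hw0, hw1, hz, hxz⟩ := mem_convexHull_iff_exists_fintype.1 hconv
  choose I hI hzI using hz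
  have hxi (i : X) : x i = ∑ k, w k * (I k).indicator 1 i := by
    simp [← hxz, hzI, Finset.sum_apply]
  have hle {k : ι} {i : X} (hi : i ∈ I k) : w k ≤ x i := by
    rw [hxi]
    refine le_trans ?_ (Finset.single_le_sum (fun l _ => mul_nonneg (hw0 l)
      (Set.indicator_nonneg (fun _ _ => zero_le_one) i)) (Finset.mem_univ k))
    simp [hi]
  have hmove (k : ι) {J : Set X} (hJ : M.Indep J) {ε : ℝ} (hε0 : 0 ≤ ε) (hε : ε ≤ w k)
      {d : X → ℝ} (hd : J.indicator 1 - (I k).indicator 1 = d)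
      (hb : ∀ i, x i + ε * d i ∈ Set.Icc 0 t) : x + ε • d ∈ indepPolytopeT M t := by
    refine ⟨?_, hb⟩
    have := add_smul_sub_mem_convexHull hw0 hw1 (fun k => ⟨I k, hI k, hzI k⟩)
      (v := J.indicator 1) (V := {v : X → ℝ | ∃ I : Set X, M.Indep I ∧ v = Set.indicator I 1})
      ⟨J, hJ, rfl⟩ k hε0 hε
    rwa [hxz, hzI, hd] at this
  have hk (k : ι) (hwk : 0 < w k) :
      ∑ j, (B \ I k).indicator D j ≤ ∑ i, (I k \ C).indicator D i := by
    refine (hI k).sum_indicator_sdiff_le hC hBC (fun i hi => h0 i ⟨w k, hwk, ?_⟩)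
      (fun j hj hji => h1 j ⟨min (w k) (t - x j), lt_min hwk (sub_pos.2 (hB j hj.1)), ?_⟩)
      (fun j hj i hi hji =>
        h2 i j ⟨min (w k) (t - x j), lt_min hwk (sub_pos.2 (hB j hj.1)), ?_⟩)
    · rw [sub_eq_add_neg, ← smul_neg]
      refine hmove k ((hI k).subset (Set.sdiff_subset (t := {i}))) hwk.le le_rfl ?_ fun l => ?_
      · ext l
        by_cases hl : l = i
        · subst hl
          simp [hi]
        · simp [hl, Set.indicator_apply]
      · have := hbox l
        by_cases hl : l = i
        · subst hl
          have := hle hi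
          simp only [Pi.neg_apply, Pi.single_eq_same, Set.mem_Icc] at *
          constructor <;> linarith
        · simpa [hl] using this
    · refine hmove k hji (le_min hwk.le (sub_pos.2 (hB j hj.1)).le) (min_le_left _ _) ?_
        fun l => ?_
      · ext l
        by_cases hl : l = j
        · subst hl
          simp [hj.2]
        · simp [hl, Set.indicator_apply]
      · have := hbox l
        by_cases hl : l = j
        · subst hl
          have := min_le_right (w k) (t - x l)
          have := le_min hwk.le (sub_pos.2 (hB l hj.1)).le
          simp only [Pi.single_eq_same, Set.mem_Icc] at *
          constructor <;> linarith
        · simpa [hl] using this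
    · have hij : i ≠ j := fun h => hj.2 (h ▸ hi)
      refine hmove k hji (le_min hwk.le (sub_pos.2 (hB j hj.1)).le) (min_le_left _ _) ?_
        fun l => ?_
      · ext l
        by_cases hl : l = j
        · subst hl
          simp [hj.2, hij.symm]
        · by_cases hl' : l = i
          · subst hl'
            simp [hi, hl]
          · simp [hl, hl', Set.indicator_apply]
      · have := hbox l
        by_cases hl : l = j
        · subst hl
          have := min_le_right (w k) (t - x l)
          have := le_min hwk.le (sub_pos.2 (hB l hj.1)).le
          simp only [Pi.sub_apply, Pi.single_eq_same, Pi.single_eq_of_ne hij.symm,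
            Set.mem_Icc] at *
          constructor <;> linarith
        · by_cases hl' : l = i
          · subst hl'
            have := hle hi
            have := min_le_left (w k) (t - x j)
            have := le_min hwk.le (sub_pos.2 (hB j hj.1)).le
            simp only [Pi.sub_apply, Pi.single_eq_same, Pi.single_eq_of_ne hij,
              Set.mem_Icc] at *
            constructor <;> linarith
          · simpa [hl, hl'] using this
  have hsum : ∑ k, w k * ∑ j, (B \ I k).indicator D j ≤
      ∑ k, w k * ∑ i, (I k \ C).indicator D i := by
    refine Finset.sum_le_sum fun k _ => ?_
    rcases (hw0 k).eq_or_lt with h | h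
    · simp [← h]
    · exact mul_le_mul_of_nonneg_left (hk k h) h.le
  simp only [Finset.mul_sum] at hsum
  rw [Finset.sum_comm, Finset.sum_comm (f := fun k i => w k * (I k \ C).indicator D i)] at hsum
  convert hsum using 2 with j _ i _
  · by_cases hj : j ∈ B
    · rw [Set.indicator_of_mem hj, Pi.sub_apply, Pi.one_apply, hxi, ← hw1,
        ← Finset.sum_sub_distrib, Finset.sum_mul]
      refine Finset.sum_congr rfl fun k _ => ?_
      by_cases hjk : j ∈ I k <;> simp [hj, hjk]
    · simp [hj]
  · by_cases hi : i ∈ C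
    · simp [hi]
    · rw [Set.indicator_of_mem hi, hxi, Finset.sum_mul]
      refine Finset.sum_congr rfl fun k _ => ?_
      by_cases hik : i ∈ I k <;> simp [hi, hik]

/-- if `t ∈ [0, (3-√5)/2]` and `x ∈ P_t(M)` is a fractional local
optimum of the multilinear extension `F` of a nonnegative submodular `f`, then
`F(x) ≥ (t - t²/2)·f(C)` for every independent set `C`. -/
theorem stmt_12 {X : Type*} [Fintype X] [DecidableEq X] (M : Matroid X)
    (hE : M.E = Set.univ)
    (f : Set X → ℝ) (hf0 : ∀ S : Set X, 0 ≤ f S)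
    (hsub : ∀ S T : Set X, f (S ∪ T) + f (S ∩ T) ≤ f S + f T)
    (t : ℝ) (ht : t ∈ Set.Icc (0 : ℝ) ((3 - Real.sqrt 5) / 2))
    (x : X → ℝ) (hx : x ∈ indepPolytopeT M t)
    (hloc1 : ∀ i : X, (∃ ε > (0 : ℝ), x - ε • (Pi.single i 1 : X → ℝ) ∈ indepPolytopeT M t) →
      0 ≤ fderiv ℝ (mExt f) x (Pi.single i 1))
    (hloc2 : ∀ j : X, (∃ ε > (0 : ℝ), x + ε • (Pi.single j 1 : X → ℝ) ∈ indepPolytopeT M t) →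
      fderiv ℝ (mExt f) x (Pi.single j 1) ≤ 0)
    (hloc3 : ∀ i j : X,
      (∃ ε > (0 : ℝ), x + ε • ((Pi.single j 1 : X → ℝ) - Pi.single i 1) ∈ indepPolytopeT M t) →
      fderiv ℝ (mExt f) x (Pi.single j 1) ≤ fderiv ℝ (mExt f) x (Pi.single i 1)) :
    ∀ C : Set X, M.Indep C → (t - t ^ 2 / 2) * f C ≤ mExt f x := by
  intro C hC
  simp only [fderiv_mExt_single] at hloc1 hloc2 hloc3
  obtain ⟨ht0, ht1⟩ := ht
  have h5 : 2 < Real.sqrt 5 := Real.lt_sqrt_of_sq_lt (by norm_num)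
  have ht1' : t ≤ 1 := by linarith
  have hquad : 0 ≤ t ^ 2 - 3 * t + 1 := by
    nlinarith [Real.sq_sqrt (show (0 : ℝ) ≤ 5 by norm_num)]
  have hx0 (i : X) : 0 ≤ x i := (hx.2 i).1
  have hxt (i : X) : x i ≤ t := (hx.2 i).2
  have hx1 (i : X) : x i ≤ 1 := (hxt i).trans ht1'
  rcases ht0.eq_or_lt with rfl | htpos
  · simpa using mExt_nonneg hf0 hx0 hx1
  set B : Set X := {j ∈ C | x j < t} with hB
  have hBC : B ⊆ C := fun j hj => hj.1
  have hBx {j : X} (hj : j ∈ C) (hjB : j ∉ B) : x j = t :=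
    (hxt j).antisymm (not_lt.1 fun h => hjB ⟨hj, h⟩)
  have key := sum_le_sum_of_isLocalOpt hx hloc1 hloc2 hloc3 hC hBC fun j hj => hj.2
  set u : X → ℝ := B.indicator 1 with hu
  set v : X → ℝ := (C \ B).indicator 1 with hv
  set d₁ : X → ℝ := B.indicator (1 - x) with hd₁
  set d₂ : X → ℝ := Cᶜ.indicator x with hd₂
  set z : X → ℝ := B.indicator x with hz
  have hval (j : X) : (u j = 1 ∧ v j = 0 ∧ d₁ j = 1 - x j ∧ d₂ j = 0 ∧ z j = x j) ∨
      (u j = 0 ∧ v j = 1 ∧ d₁ j = 0 ∧ d₂ j = 0 ∧ z j = 0 ∧ x j = t) ∨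
      (u j = 0 ∧ v j = 0 ∧ d₁ j = 0 ∧ d₂ j = x j ∧ z j = 0) := by
    by_cases hjB : j ∈ B
    · simp [hu, hv, hd₁, hd₂, hz, hjB, hBC hjB]
    · by_cases hjC : j ∈ C
      · simp [hu, hv, hd₁, hd₂, hz, hjB, hjC, hBx hjC hjB]
      · simp [hu, hv, hd₁, hd₂, hz, hjB, hjC]
  have hxeq : z + t • v + d₂ = x := by
    ext j
    simp only [Pi.add_apply, Pi.smul_apply, smul_eq_mul]
    rcases hval j with h | h | h <;> simp [h]
  have hyeq : u + t • v + t • (t⁻¹ • d₂) = x + d₁ := by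
    ext j
    simp only [Pi.add_apply, Pi.smul_apply, smul_eq_mul, mul_inv_cancel_left₀ htpos.ne']
    rcases hval j with h | h | h <;> simp [h]
  have huv : u + v = C.indicator 1 := by
    ext j
    by_cases hjB : j ∈ B
    · simp [hu, hv, hjB, hBC hjB]
    · by_cases hjC : j ∈ C <;> simp [hu, hv, hjB, hjC]
  have hdiv (j : X) : 0 ≤ t⁻¹ * x j ∧ t⁻¹ * x j ≤ 1 :=
    ⟨mul_nonneg (inv_nonneg.2 ht0) (hx0 j), (inv_mul_le_one₀ htpos).2 (hxt j)⟩
  have hup : mExt f (x + d₁) - mExt f x ≤ ∑ i, d₁ i * mExt (marginal i f) x := by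
    refine mExt_sub_le hsub hx0 (fun j => ?_) fun j => ?_ <;>
      rcases hval j with h | h | h <;> simp [h, hx1, ht1']
  have hdown : ∑ i, d₂ i * mExt (marginal i f) x ≤ mExt f x - mExt f (z + t • v) := by
    have := le_mExt_sub hsub (a := z + t • v) (d := d₂) (fun j => ?_) (fun j => ?_) fun j => ?_
    · rwa [hxeq] at this
    all_goals rcases hval j with h | h | h <;> simp [h, hx0, hx1, ht0, ht1']
  have hy : (1 - t) * mExt f (u + t • v) ≤ mExt f (x + d₁) := by
    have h := le_mExt_add_smul hsub (a := u + t • v) (d := t⁻¹ • d₂)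
      (fun j => ?_) (fun j => ?_) (fun j => ?_) ht0 ht1'
    · rw [hyeq] at h
      have := mul_nonneg ht0 (mExt_nonneg hf0 (x := u + t • v + t⁻¹ • d₂)
        (fun j => ?_) (fun j => ?_))
      · linarith
      all_goals rcases hval j with h | h | h <;> simp [h, hdiv, ht0, ht1']
    all_goals rcases hval j with h | h | h <;> simp [h, hdiv, ht0, ht1']
  have hm : (1 - t) * f B + t * f C ≤ mExt f (u + t • v) := by
    have h := le_mExt_add_smul hsub (a := u) (d := v)
      (fun j => ?_) (fun j => ?_) (fun j => ?_) ht0 ht1'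
    · rwa [huv, hu, mExt_indicator, mExt_indicator] at h
    all_goals rcases hval j with h | h | h <;> simp [h]
  have hzle : mExt f (u + t • v) - f B ≤ mExt f (z + t • v) := by
    have h := mExt_add_sub_le_of_le hsub (a := z) (b := u) (d := t • v)
      (fun j => ?_) (fun j => ?_) (fun j => ?_) (fun j => ?_)
    · have hz0 := mExt_nonneg hf0 (x := z) (fun j => ?_) (fun j => ?_)
      · rw [← mExt_indicator f B]
        linarith
      all_goals rcases hval j with h | h | h <;> simp [h, hx0, hx1]
    all_goals rcases hval j with h | h | h <;> simp [h, hx0, hx1, ht0, ht1']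
  nlinarith [mul_le_mul_of_nonneg_left hm (show 0 ≤ 2 - t by linarith),
    mul_nonneg hquad (hf0 B)]
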